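/- Let S be a commutative ring and x ∈ S a nonzerodivisor. Let D₂ ∈ Mat_{b₁×b₂}(S), D₁ ∈ Mat_{b₀×b₁}(S), D₀ ∈ Mat_{b₋₁×b₀}(S) and suppose there are matrices M₁ ∈ Mat_{b₋₁×b₁}(S) and M₂ ∈ Mat_{b₀×b₂}(S) with D₀D₁ = x·M₁ and D₁D₂ = x·M₂. Then M₁D₂ = D₀M₂, and consequently the block matrices satisfy [[D₁, x·I_{b₀}],[M₁, D₀]] · [[D₂, −x·I_{b₁}],[−M₂, D₁]] = 0. -/

import Mathlib

/-- Let `S` be a commutative ring and `x ∈ S` a nonzerodivisor.  Let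
`D₂ ∈ Mat_{b₁×b₂}(S)`, `D₁ ∈ Mat_{b₀×b₁}(S)`, `D₀ ∈ Mat_{b₋₁×b₀}(S)` and suppose there are
matrices `M₁ ∈ Mat_{b₋₁×b₁}(S)` and `M₂ ∈ Mat_{b₀×b₂}(S)` with `D₀D₁ = x·M₁` and
`D₁D₂ = x·M₂`.  Then `M₁D₂ = D₀M₂`, and consequently the block matrices satisfy
`[[D₁, x·I],[M₁, D₀]] · [[D₂, −x·I],[−M₂, D₁]] = 0`. -/
theorem statement2 (S : Type) [CommRing S] (x : S) (hx : x ∈ nonZeroDivisors S)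
    (b₂ b₁ b₀ bm : ℕ)
    (D₂ : Matrix (Fin b₁) (Fin b₂) S) (D₁ : Matrix (Fin b₀) (Fin b₁) S)
    (D₀ : Matrix (Fin bm) (Fin b₀) S)
    (M₁ : Matrix (Fin bm) (Fin b₁) S) (M₂ : Matrix (Fin b₀) (Fin b₂) S)
    (h₁ : D₀ * D₁ = x • M₁) (h₂ : D₁ * D₂ = x • M₂) :
    M₁ * D₂ = D₀ * M₂ ∧
    Matrix.fromBlocks D₁ (x • (1 : Matrix (Fin b₀) (Fin b₀) S)) M₁ D₀ *
      Matrix.fromBlocks D₂ (-(x • (1 : Matrix (Fin b₁) (Fin b₁) S))) (-M₂) D₁ = 0 := by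
  have key : M₁ * D₂ = D₀ * M₂ := by
    have h : x • (M₁ * D₂) = x • (D₀ * M₂) := by
      rw [← Matrix.smul_mul, ← h₁, Matrix.mul_assoc, h₂, Matrix.mul_smul]
    ext i j
    have hij := congrFun (congrFun h i) j
    simp only [Matrix.smul_apply, smul_eq_mul] at hij
    exact (mul_cancel_left_mem_nonZeroDivisors hx).1 hij
  refine ⟨key, ?_⟩
  rw [Matrix.fromBlocks_multiply, ← Matrix.fromBlocks_zero]
  congr 1 <;> simp [h₁, h₂, key]
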